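/- (Lemma 3.1) For k ≥ 2 set k_{ii} = k and k_{ij} = k^{(i−j)k} for 1 ≤ j < i ≤ p, and define the prior density on T⁺ by π_k(Θ) = ∏_{i=1}^p (k θ_{ii})^{−1} φ((log θ_{ii})/k) · ∏_{1 ≤ j < i ≤ p} (k_{ij} θ_{ii})^{−1} φ(θ_{ij}/(θ_{ii} k_{ij})). For ω = (ω_{ij})_{1 ≤ j ≤ i ≤ p} ∈ ℝ^{p(p+1)/2}, define Θ_k(ω) ∈ T⁺ by (Θ_k(ω))_{ii} = exp(k ω_{ii}) and (Θ_k(ω))_{ij} = k_{ij} ω_{ij} exp(k ω_{ii}) for j < i. Define δ*_k(L | Θ) = ( ∫_{T⁺} Yᵀ Y f_W(L | Y) π_k(YΘ) dY )^{−1} · ( ∫_{T⁺} f_W(L | Y) π_k(YΘ) dY ). Then for every L ∈ T⁺ and every ω ∈ ℝ^{p(p+1)/2}, lim_{k→∞} δ*_k(L | Θ_k(ω)) = L diag(d₁, …, d_p) Lᵀ, where d_i = 1/(n+p−2i+1). -/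

import Mathlib

open MeasureTheory ENNReal Matrix

abbrev LowIdx (p : ℕ) := {q : Fin p × Fin p // q.2 ≤ q.1}
abbrev TriCoords (p : ℕ) := LowIdx p → ℝ

noncomputable def triMat {p : ℕ} (x : TriCoords p) : Matrix (Fin p) (Fin p) ℝ :=
  Matrix.of fun i j => if h : j ≤ i then x ⟨(i, j), h⟩ else 0

def triPos (p : ℕ) : Set (TriCoords p) :=
  {x | ∀ i : Fin p, 0 < x ⟨(i, i), le_rfl⟩}

noncomputable def gammaDens {p : ℕ} (x : TriCoords p) : ℝ≥0∞ :=
  ∏ i : Fin p, ENNReal.ofReal (x ⟨(i, i), le_rfl⟩ ^ (-((i : ℕ) + 1) : ℤ))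

noncomputable def gammaDensR {p : ℕ} (x : TriCoords p) : ℝ :=
  ∏ i : Fin p, x ⟨(i, i), le_rfl⟩ ^ (-((i : ℕ) + 1) : ℤ)

instance matrixMeasurableSpace {p : ℕ} : MeasurableSpace (Matrix (Fin p) (Fin p) ℝ) :=
  inferInstanceAs (MeasurableSpace (Fin p → Fin p → ℝ))

def memTplus {p : ℕ} (A : Matrix (Fin p) (Fin p) ℝ) : Prop :=
  (∀ i j : Fin p, i < j → A i j = 0) ∧ ∀ i : Fin p, 0 < A i i

noncomputable def wishartC (p n : ℕ) : ℝ :=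
  2 ^ ((p : ℝ) * ((n : ℝ) - 2) / 2) * Real.pi ^ ((p : ℝ) * ((p : ℝ) - 1) / 4) *
    ∏ i : Fin p, Real.Gamma (((n : ℝ) - (i : ℕ)) / 2)

noncomputable def wishartDens (p n : ℕ) (Θ T : Matrix (Fin p) (Fin p) ℝ) : ℝ :=
  (Θ * T).det ^ n * Real.exp (-(1 / 2) * ((Θ * T) * (Θ * T)ᵀ).trace) / wishartC p n

open Filter Topology

/-- The standard normal density. -/
noncomputable def stdNormal (t : ℝ) : ℝ :=
  Real.exp (-(t ^ 2) / 2) / Real.sqrt (2 * Real.pi)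

/-- The scaling constants `k_{ij} = k^{(i-j)k}` (for `j < i`; `k_{ii} = k`). -/
noncomputable def kScale (p : ℕ) (k : ℝ) (i j : Fin p) : ℝ :=
  k ^ ((((i : ℕ) : ℝ) - ((j : ℕ) : ℝ)) * k)

/-- The Gaussian prior density `π_k(Θ)` on `T⁺`, in the coordinates
`ξ_{ii} = log θ_{ii}`, `ξ_{ij} = θ_{ij}/θ_{ii}` (for `j < i`), where
`ξ_{ii} ∼ N(0, k²)` and `ξ_{ij} ∼ N(0, k_{ij}²)` independently. -/
noncomputable def priorK (p : ℕ) (k : ℝ) (Θ : Matrix (Fin p) (Fin p) ℝ) : ℝ :=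
  (∏ i : Fin p, stdNormal (Real.log (Θ i i) / k) / (k * Θ i i)) *
    ∏ i : Fin p, ∏ j ∈ Finset.univ.filter (fun j : Fin p => j < i),
      stdNormal (Θ i j / (Θ i i * kScale p k i j)) / (kScale p k i j * Θ i i)

/-- The matrix `Θ_k(ω)`: `(Θ_k(ω))_{ii} = exp(k ω_{ii})` and
`(Θ_k(ω))_{ij} = k_{ij} ω_{ij} exp(k ω_{ii})` for `j < i`. -/
noncomputable def thetaK (p : ℕ) (k : ℝ) (ω : TriCoords p) : Matrix (Fin p) (Fin p) ℝ :=
  Matrix.of fun i j =>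
    if h : j ≤ i then
      if i = j then Real.exp (k * ω ⟨(i, i), le_rfl⟩)
      else kScale p k i j * ω ⟨(i, j), h⟩ * Real.exp (k * ω ⟨(i, i), le_rfl⟩)
    else 0

/-- The truncated Gaussian moment `∫₀^∞ t^m exp(-t²/2) dt`. -/
noncomputable def halfGaussianMoment (m : ℕ) : ℝ :=
  ∫ t in Set.Ioi (0 : ℝ), t ^ m * Real.exp (-(t ^ 2) / 2)

lemma halfGaussianMoment_eq_gamma (m : ℕ) :
    halfGaussianMoment m =
      (1 / 2 : ℝ) ^ (-((m : ℝ) + 1) / 2) * (1 / 2) * Real.Gamma (((m : ℝ) + 1) / 2) := by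
  rw [← integral_rpow_mul_exp_neg_mul_rpow (p := 2) (q := m) (b := 1 / 2) (by norm_num)
    (by have := Nat.cast_nonneg (α := ℝ) m; linarith) (by norm_num)]
  refine setIntegral_congr_fun measurableSet_Ioi fun t _ => ?_
  simp only [Real.rpow_natCast, Real.rpow_ofNat]
  congr 2
  ring

lemma halfGaussianMoment_add_two (m : ℕ) :
    halfGaussianMoment (m + 2) = ((m : ℝ) + 1) * halfGaussianMoment m := by
  have hm : (0 : ℝ) < ((m : ℝ) + 1) / 2 := by positivity
  rw [halfGaussianMoment_eq_gamma, halfGaussianMoment_eq_gamma]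
  have h1 : (((m + 2 : ℕ) : ℝ) + 1) / 2 = ((m : ℝ) + 1) / 2 + 1 := by push_cast; ring
  have h2 : -(((m + 2 : ℕ) : ℝ) + 1) / 2 = -((m : ℝ) + 1) / 2 - 1 := by push_cast; ring
  rw [h1, h2, Real.Gamma_add_one hm.ne', Real.rpow_sub_one (by norm_num)]
  ring

lemma halfGaussianMoment_pos (m : ℕ) : 0 < halfGaussianMoment m := by
  rw [halfGaussianMoment_eq_gamma]
  have : 0 < Real.Gamma (((m : ℝ) + 1) / 2) := Real.Gamma_pos_of_pos (by positivity)
  positivity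

lemma integrable_pow_mul_gaussian (m : ℕ) :
    Integrable fun t : ℝ => t ^ m * Real.exp (-(t ^ 2) / 2) := by
  have h := integrable_rpow_mul_exp_neg_mul_sq (b := 1 / 2) (by norm_num) (s := m)
    (by have := Nat.cast_nonneg (α := ℝ) m; linarith)
  refine h.congr (.of_forall fun t => ?_)
  simp only [Real.rpow_natCast]
  congr 2
  ring

/-- One coordinate factor of the Cholesky-factor weight: on the diagonal entry `(i, i)` it is
`t^{n-1-i} exp(-t²/2)` on `t > 0`, off the diagonal it is `exp(-t²/2)`. -/
noncomputable def coordWeight {p : ℕ} (n : ℕ) (q : LowIdx p) (t : ℝ) : ℝ :=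
  (if q.1.1 = q.1.2 then (Set.Ioi (0 : ℝ)).indicator (fun t => t ^ (n - 1 - (q.1.1 : ℕ))) t
    else 1) * Real.exp (-(t ^ 2) / 2)

/-- The ratio of the second to the zeroth moment of `coordWeight`. -/
noncomputable def secondMoment {p : ℕ} (n : ℕ) (q : LowIdx p) : ℝ :=
  if q.1.1 = q.1.2 then (n : ℝ) - (q.1.1 : ℕ) else 1

section CoordWeight

variable {p n : ℕ} (q : LowIdx p)

lemma pow_mul_coordWeight_diag (h : q.1.1 = q.1.2) (m : ℕ) :
    (fun t => t ^ m * coordWeight n q t) = (Set.Ioi (0 : ℝ)).indicator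
      (fun t => t ^ (n - 1 - (q.1.1 : ℕ) + m) * Real.exp (-(t ^ 2) / 2)) := by
  ext t
  by_cases ht : t ∈ Set.Ioi (0 : ℝ)
  · simp only [coordWeight, h, if_true, Set.indicator_of_mem ht]
    ring
  · simp [coordWeight, h, Set.indicator_of_notMem ht]

lemma coordWeight_off (h : q.1.1 ≠ q.1.2) (t : ℝ) :
    coordWeight n q t = Real.exp (-(t ^ 2) / 2) := by
  simp [coordWeight, h]

lemma integrable_pow_mul_coordWeight (m : ℕ) :
    Integrable fun t => t ^ m * coordWeight n q t := by
  by_cases h : q.1.1 = q.1.2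
  · rw [pow_mul_coordWeight_diag q h]
    exact (integrable_pow_mul_gaussian _).indicator measurableSet_Ioi
  · simpa only [coordWeight_off q h] using integrable_pow_mul_gaussian m

lemma integral_gaussian_even (m : ℕ) (hm : Even m) :
    ∫ t : ℝ, t ^ m * Real.exp (-(t ^ 2) / 2) = 2 * halfGaussianMoment m := by
  rw [halfGaussianMoment, ← integral_comp_abs (f := fun t : ℝ => t ^ m * Real.exp (-(t ^ 2) / 2))]
  simp only [hm.pow_abs, sq_abs]

lemma integral_coordWeight_pos : 0 < ∫ t, coordWeight n q t := by
  by_cases h : q.1.1 = q.1.2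
  · have := pow_mul_coordWeight_diag (n := n) q h 0
    simp only [pow_zero, one_mul, add_zero] at this
    rw [this, integral_indicator measurableSet_Ioi]
    exact halfGaussianMoment_pos _
  · have := integral_gaussian_even 0 (by simp)
    simp only [pow_zero, one_mul] at this
    simp only [coordWeight_off q h, this]
    exact mul_pos two_pos (halfGaussianMoment_pos _)

lemma integral_id_mul_coordWeight (h : q.1.1 ≠ q.1.2) :
    ∫ t, t ^ 1 * coordWeight n q t = 0 := by
  simp only [coordWeight_off q h]
  have := integral_neg_eq_self (fun t : ℝ => t ^ 1 * Real.exp (-(t ^ 2) / 2)) volume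
  simp only [pow_one, neg_sq, neg_mul, integral_neg] at this ⊢
  linarith

lemma integral_sq_mul_coordWeight (hn : p ≤ n) :
    ∫ t, t ^ 2 * coordWeight n q t = secondMoment n q * ∫ t, coordWeight n q t := by
  by_cases h : q.1.1 = q.1.2
  · have h0 := pow_mul_coordWeight_diag (n := n) q h 0
    simp only [pow_zero, one_mul, add_zero] at h0
    rw [h0, pow_mul_coordWeight_diag q h, integral_indicator measurableSet_Ioi,
      integral_indicator measurableSet_Ioi]
    have := halfGaussianMoment_add_two (n - 1 - (q.1.1 : ℕ))
    have hlt : (q.1.1 : ℕ) + 1 ≤ n := lt_of_lt_of_le q.1.1.2 hn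
    have hc : ((n - 1 - (q.1.1 : ℕ) : ℕ) : ℝ) + 1 = n - (q.1.1 : ℕ) := by
      rw [Nat.sub_sub, Nat.cast_sub (by omega)]
      push_cast
      ring
    rw [hc] at this
    simpa only [secondMoment, h, if_true, halfGaussianMoment] using this
  · have h0 := integral_gaussian_even 0 (by simp)
    have h2 := integral_gaussian_even 2 (by simp)
    simp only [pow_zero, one_mul] at h0
    simp only [coordWeight_off q h, h0, h2, secondMoment, h, if_false]
    simp [halfGaussianMoment_add_two 0]

end CoordWeight

/-- The weight `∏_i z_{ii}^{n-1-i} exp(-‖z‖²/2)` on lower-triangular coordinates with positive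
diagonal. -/
noncomputable def triWeight {p : ℕ} (n : ℕ) (z : TriCoords p) : ℝ :=
  ∏ q, coordWeight n q (z q)

section TriWeight

variable {p n : ℕ}

lemma integral_triWeight_pos : 0 < ∫ z : TriCoords p, triWeight n z := by
  simp only [triWeight]
  rw [integral_fintype_prod_volume_eq_prod]
  exact Finset.prod_pos fun q _ => integral_coordWeight_pos q

lemma mul_mul_triWeight (a b : LowIdx p) (z : TriCoords p) :
    z a * z b * triWeight n z =
      ∏ q, z q ^ ((if q = a then 1 else 0) + if q = b then 1 else 0) * coordWeight n q (z q) := by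
  have h (c : LowIdx p) : z c = ∏ q, z q ^ (if q = c then 1 else 0) := by simp [pow_ite]
  simp only [triWeight, Finset.prod_mul_distrib, pow_add, ← h]

lemma integrable_triWeight : Integrable fun z : TriCoords p => triWeight n z := by
  refine Integrable.fintype_prod (f := fun q => coordWeight n q) fun q => ?_
  simpa using integrable_pow_mul_coordWeight (n := n) q 0

lemma integrable_mul_mul_triWeight (a b : LowIdx p) :
    Integrable fun z : TriCoords p => z a * z b * triWeight n z := by
  simp only [mul_mul_triWeight]
  exact Integrable.fintype_prod (f := fun q t =>
    t ^ ((if q = a then 1 else 0) + if q = b then 1 else 0) * coordWeight n q t)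
    fun q => integrable_pow_mul_coordWeight q _

lemma integral_mul_mul_triWeight (a b : LowIdx p) :
    ∫ z : TriCoords p, z a * z b * triWeight n z =
      ∏ q, ∫ t, t ^ ((if q = a then 1 else 0) + if q = b then 1 else 0) * coordWeight n q t := by
  simp only [mul_mul_triWeight]
  exact integral_fintype_prod_volume_eq_prod (fun q t =>
    t ^ ((if q = a then 1 else 0) + if q = b then 1 else 0) * coordWeight n q t)

lemma integral_mul_mul_triWeight_of_ne {a b : LowIdx p} (hab : a ≠ b) (ha : a.1.1 ≠ a.1.2) :
    ∫ z : TriCoords p, z a * z b * triWeight n z = 0 := by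
  rw [integral_mul_mul_triWeight]
  refine Finset.prod_eq_zero (Finset.mem_univ a) ?_
  simpa [hab] using integral_id_mul_coordWeight (n := n) a ha

lemma integral_sq_triWeight (hn : p ≤ n) (a : LowIdx p) :
    ∫ z : TriCoords p, z a * z a * triWeight n z =
      secondMoment n a * ∫ z : TriCoords p, triWeight n z := by
  have h0 : ∫ z : TriCoords p, triWeight n z = ∏ q, ∫ t, coordWeight n q t :=
    integral_fintype_prod_volume_eq_prod _
  have hr : secondMoment n a = ∏ q : LowIdx p, if q = a then secondMoment n q else 1 := by
    simp
  rw [integral_mul_mul_triWeight, h0, hr, ← Finset.prod_mul_distrib]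
  refine Finset.prod_congr rfl fun q _ => ?_
  by_cases h : q = a
  · simpa [h] using integral_sq_mul_coordWeight a hn
  · simp [h]

lemma integrable_triMat_mul_triMat (l l' i j : Fin p) :
    Integrable fun z : TriCoords p => triMat z l i * triMat z l' j * triWeight n z := by
  by_cases hi : i ≤ l
  · by_cases hj : j ≤ l'
    · simpa [triMat, hi, hj] using integrable_mul_mul_triWeight (n := n) ⟨(l, i), hi⟩ ⟨(l', j), hj⟩
    · simp [triMat, hj]
  · simp [triMat, hi]

lemma integral_triMat_mul_triMat_of_lt (l : Fin p) {i j : Fin p} (hij : i < j) :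
    ∫ z : TriCoords p, triMat z l i * triMat z l j * triWeight n z = 0 := by
  by_cases hj : j ≤ l
  · have hi : i ≤ l := hij.le.trans hj
    simpa [triMat, hi, hj] using integral_mul_mul_triWeight_of_ne (n := n)
      (a := ⟨(l, i), hi⟩) (b := ⟨(l, j), hj⟩) (by simp [hij.ne]) (hij.trans_le hj).ne'
  · simp [triMat, hj]

lemma integrable_gram_triWeight (i j : Fin p) :
    Integrable fun z : TriCoords p => ((triMat z)ᵀ * triMat z) i j * triWeight n z := by
  simp only [Matrix.mul_apply, Matrix.transpose_apply, Finset.sum_mul]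
  exact integrable_finsetSum _ fun l _ => integrable_triMat_mul_triMat l l i j

lemma integral_gram_triWeight (hn : p ≤ n) (i j : Fin p) :
    ∫ z : TriCoords p, ((triMat z)ᵀ * triMat z) i j * triWeight n z =
      Matrix.diagonal (fun i : Fin p => (n : ℝ) + p - 2 * ((i : ℕ) : ℝ) - 1) i j *
        ∫ z : TriCoords p, triWeight n z := by
  simp only [Matrix.mul_apply, Matrix.transpose_apply, Finset.sum_mul]
  rw [integral_finsetSum _ fun l _ => integrable_triMat_mul_triMat l l i j]
  rcases lt_trichotomy i j with h | rfl | h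
  · simp [integral_triMat_mul_triMat_of_lt _ h, h.ne]
  · have key (l : Fin p) : ∫ z : TriCoords p, triMat z l i * triMat z l i * triWeight n z =
        ((if l = i then (n : ℝ) - (i : ℕ) else 0) + if i < l then 1 else 0) *
          ∫ z : TriCoords p, triWeight n z := by
      by_cases hl : i ≤ l
      · rcases hl.eq_or_lt with rfl | hlt
        · simpa [triMat, secondMoment] using integral_sq_triWeight hn ⟨(i, i), le_rfl⟩
        · simpa [triMat, secondMoment, hl, hlt, hlt.ne'] using
            integral_sq_triWeight hn ⟨(l, i), hl⟩
      · have h1 : l ≠ i := fun h => hl h.ge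
        have h2 : ¬ i < l := fun h => hl h.le
        simp [triMat, hl, h1, h2]
    rw [Finset.sum_congr rfl fun l _ => key l, ← Finset.sum_mul, Finset.sum_add_distrib]
    congr 1
    have hcard : (∑ l : Fin p, if i < l then (1 : ℝ) else 0) = p - 1 - (i : ℕ) := by
      rw [Finset.sum_boole]
      have : (Finset.univ.filter fun l : Fin p => i < l) = Finset.Ioi i := by ext; simp
      rw [this, Fin.card_Ioi, Nat.sub_sub, Nat.cast_sub (by omega)]
      push_cast
      ring
    rw [hcard]
    simp
    ring
  · simp only [mul_comm (triMat _ _ i)]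
    simp [integral_triMat_mul_triMat_of_lt _ h, h.ne']

end TriWeight

section TriMat

variable {p n : ℕ} {A L : Matrix (Fin p) (Fin p) ℝ}

lemma triMat_apply_of_lt (y : TriCoords p) {i j : Fin p} (h : i < j) : triMat y i j = 0 := by
  simp [triMat, h.not_ge]

lemma triMat_apply_diag (y : TriCoords p) (i : Fin p) : triMat y i i = y ⟨(i, i), le_rfl⟩ := by
  simp [triMat]

lemma triMat_mul_apply_diag (y : TriCoords p) (hA : ∀ i j : Fin p, i < j → A i j = 0)
    (i : Fin p) : (triMat y * A) i i = y ⟨(i, i), le_rfl⟩ * A i i := by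
  rw [Matrix.mul_apply, Finset.sum_eq_single i, triMat_apply_diag]
  · intro l _ hl
    rcases hl.lt_or_gt with h | h
    · rw [hA l i h, mul_zero]
    · rw [triMat_apply_of_lt y h, zero_mul]
  · simp

lemma det_eq_prod_diag (hA : ∀ i j : Fin p, i < j → A i j = 0) : A.det = ∏ i, A i i :=
  Matrix.det_of_isLowerTriangular A fun i j h => hA i j h

lemma memTplus.det_ne_zero (hL : memTplus L) : L.det ≠ 0 := by
  rw [det_eq_prod_diag hL.1]
  exact Finset.prod_ne_zero_iff.2 fun i _ => (hL.2 i).ne'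

/-- Right multiplication by a matrix, read on the lower-triangular coordinates. -/
noncomputable def mulRightCoords (A : Matrix (Fin p) (Fin p) ℝ) :
    TriCoords p →ₗ[ℝ] TriCoords p where
  toFun y q := (triMat y * A) q.1.1 q.1.2
  map_add' x y := by
    have : triMat (x + y) = triMat x + triMat y := by
      ext i j
      by_cases h : j ≤ i <;> simp [triMat, h]
    ext q
    simp [this, add_mul]
  map_smul' c y := by
    have : triMat (c • y) = c • triMat y := by
      ext i j
      by_cases h : j ≤ i <;> simp [triMat, h]
    ext q
    simp [this]

lemma triMat_mulRightCoords (hA : ∀ i j : Fin p, i < j → A i j = 0) (y : TriCoords p) :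
    triMat (mulRightCoords A y) = triMat y * A := by
  ext i j
  by_cases h : j ≤ i
  · simp [triMat, h, mulRightCoords]
  · rw [triMat_apply_of_lt _ (not_le.1 h), Matrix.mul_apply]
    refine (Finset.sum_eq_zero fun l _ => ?_).symm
    rcases le_or_gt l i with hl | hl
    · rw [hA l j (hl.trans_lt (not_le.1 h)), mul_zero]
    · rw [triMat_apply_of_lt y hl, zero_mul]

lemma mulRightCoords_diag (hA : ∀ i j : Fin p, i < j → A i j = 0) (y : TriCoords p) (i : Fin p) :
    mulRightCoords A y ⟨(i, i), le_rfl⟩ = y ⟨(i, i), le_rfl⟩ * A i i :=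
  triMat_mul_apply_diag y hA i

lemma triMat_injective : Function.Injective (triMat (p := p)) := by
  intro x y h
  ext ⟨⟨i, j⟩, hq⟩
  have := congrFun (congrFun h i) j
  simpa [triMat, show j ≤ i from hq] using this

lemma mulRightCoords_injective (hL : memTplus L) : Function.Injective (mulRightCoords L) := by
  intro x y h
  have h' : triMat x * L = triMat y * L := by
    rw [← triMat_mulRightCoords hL.1, ← triMat_mulRightCoords hL.1, h]
  have hu : IsUnit L := (Matrix.isUnit_iff_isUnit_det L).2 hL.det_ne_zero.isUnit
  exact triMat_injective (hu.mul_right_cancel h')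

lemma exists_integral_comp_mulRightCoords (hL : memTplus L) :
    ∃ c : ℝ, 0 < c ∧ ∀ g : TriCoords p → ℝ,
      (Integrable g → Integrable fun y => g (mulRightCoords L y)) ∧
      ∫ y, g (mulRightCoords L y) = c * ∫ z, g z := by
  have hdet : LinearMap.det (mulRightCoords L) ≠ 0 :=
    (LinearEquiv.isUnit_det' (LinearEquiv.ofInjectiveEndo _ (mulRightCoords_injective hL))).ne_zero
  have hmap := Measure.map_linearMap_addHaar_eq_smul_addHaar (volume : Measure (TriCoords p)) hdet
  have hemb : MeasurableEmbedding (mulRightCoords L) :=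
    (LinearEquiv.ofInjectiveEndo _
      (mulRightCoords_injective hL)).toContinuousLinearEquiv.toHomeomorph.measurableEmbedding
  refine ⟨|(LinearMap.det (mulRightCoords L))⁻¹|, abs_pos.2 (inv_ne_zero hdet), fun g => ⟨?_, ?_⟩⟩
  · intro hg
    have := hg.smul_measure (c := ENNReal.ofReal |(LinearMap.det (mulRightCoords L))⁻¹|)
      ENNReal.ofReal_ne_top
    rw [← hmap] at this
    exact hemb.integrable_map_iff.1 this
  · rw [← hemb.integral_map, hmap, integral_smul_measure,
      ENNReal.toReal_ofReal (abs_nonneg _), smul_eq_mul]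

lemma prod_lowIdx_diag (f : Fin p → ℝ) :
    ∏ q : LowIdx p, (if q.1.1 = q.1.2 then f q.1.1 else 1) = ∏ i, f i := by
  rw [← Finset.prod_filter]
  refine (Finset.prod_bij' (fun i _ => ⟨(i, i), le_rfl⟩) (fun q _ => q.1.1) ?_ ?_ ?_ ?_ ?_).symm
  · simp
  · simp
  · simp
  · rintro ⟨⟨i, j⟩, hq⟩ h
    have : i = j := by simpa using h
    simp [this]
  · simp

lemma trace_triMat_mul_transpose (z : TriCoords p) :
    (triMat z * (triMat z)ᵀ).trace = ∑ q, z q ^ 2 := by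
  have h : (triMat z * (triMat z)ᵀ).trace = ∑ x : Fin p × Fin p, triMat z x.1 x.2 ^ 2 := by
    rw [Fintype.sum_prod_type]
    simp [Matrix.trace, Matrix.mul_apply, sq]
  rw [h, ← Finset.sum_subset (Finset.filter_subset (fun x : Fin p × Fin p => x.2 ≤ x.1) _)]
  · rw [Finset.sum_subtype (p := fun x : Fin p × Fin p => x.2 ≤ x.1) _ (by simp)]
    refine Finset.sum_congr rfl fun q _ => ?_
    simp [triMat, q.2]
  · intro x _ hx
    rw [triMat_apply_of_lt z (by simpa using hx)]
    simp

lemma triWeight_of_mem {z : TriCoords p} (hz : z ∈ triPos p) :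
    triWeight n z = (∏ i : Fin p, z ⟨(i, i), le_rfl⟩ ^ (n - 1 - (i : ℕ))) *
      Real.exp (-(1 / 2) * (triMat z * (triMat z)ᵀ).trace) := by
  rw [trace_triMat_mul_transpose, ← prod_lowIdx_diag, Finset.mul_sum, Real.exp_sum,
    ← Finset.prod_mul_distrib]
  refine Finset.prod_congr rfl fun q _ => ?_
  rw [coordWeight]
  congr 1
  · obtain ⟨⟨i, j⟩, hq⟩ := q
    by_cases h : i = j
    · subst h
      simp [Set.indicator_of_mem (show z ⟨(i, i), hq⟩ ∈ Set.Ioi (0 : ℝ) from hz i)]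
    · simp [h]
  · congr 1
    ring

lemma triWeight_of_notMem {z : TriCoords p} (hz : z ∉ triPos p) : triWeight n z = 0 := by
  simp only [triPos, Set.mem_ofPred_eq, not_forall] at hz
  obtain ⟨i, hi⟩ := hz
  refine Finset.prod_eq_zero (Finset.mem_univ ⟨(i, i), le_rfl⟩) ?_
  simp [coordWeight, Set.indicator_of_notMem (show z ⟨(i, i), le_rfl⟩ ∉ Set.Ioi (0 : ℝ) from hi)]

lemma mulRightCoords_mem_triPos (hL : memTplus L) {y : TriCoords p} :
    mulRightCoords L y ∈ triPos p ↔ y ∈ triPos p := by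
  simp only [triPos, Set.mem_ofPred_eq, mulRightCoords_diag hL.1]
  exact forall_congr' fun i => mul_pos_iff_of_pos_right (hL.2 i)

lemma wishartC_pos (hn : p ≤ n) : 0 < wishartC p n := by
  refine mul_pos (by positivity) (Finset.prod_pos fun i _ => Real.Gamma_pos_of_pos ?_)
  have : ((i : ℕ) : ℝ) < n := by exact_mod_cast i.2.trans_le hn
  linarith

lemma measurableSet_triPos : MeasurableSet (triPos p) := by
  simp only [triPos, Set.ofPred_forall]
  exact MeasurableSet.iInter fun i => measurableSet_lt measurable_const (measurable_pi_apply _)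

end TriMat

/-- The product of the standard normal factors of the prior density at `Y Θ_k(ω)`. -/
noncomputable def normalFactor (p : ℕ) (k : ℝ) (ω y : TriCoords p) : ℝ :=
  (∏ i : Fin p, stdNormal (Real.log ((triMat y * thetaK p k ω) i i) / k)) *
    ∏ i : Fin p, ∏ j ∈ Finset.univ.filter (fun j : Fin p => j < i),
      stdNormal ((triMat y * thetaK p k ω) i j /
        ((triMat y * thetaK p k ω) i i * kScale p k i j))

/-- The limit of `normalFactor` as `k → ∞`. -/
noncomputable def normalFactorLim {p : ℕ} (ω : TriCoords p) : ℝ :=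
  (∏ i : Fin p, stdNormal (ω ⟨(i, i), le_rfl⟩)) *
    ∏ i : Fin p, ∏ j ∈ Finset.univ.filter (fun j : Fin p => j < i), stdNormal (triMat ω i j)

lemma stdNormal_pos (t : ℝ) : 0 < stdNormal t := by
  unfold stdNormal
  positivity

lemma stdNormal_le_one (t : ℝ) : stdNormal t ≤ 1 := by
  have h1 : 1 ≤ Real.sqrt (2 * Real.pi) :=
    Real.one_le_sqrt.2 (by linarith [Real.pi_gt_three])
  have h2 : Real.exp (-(t ^ 2) / 2) ≤ 1 := Real.exp_le_one_iff.2 (by linarith [sq_nonneg t])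
  exact div_le_one_of_le₀ (h2.trans h1) (Real.sqrt_nonneg _)

lemma continuous_stdNormal : Continuous stdNormal := by
  unfold stdNormal
  fun_prop

section Prior

variable {p n : ℕ} {L : Matrix (Fin p) (Fin p) ℝ}

lemma normalFactorLim_pos (ω : TriCoords p) : 0 < normalFactorLim ω :=
  mul_pos (Finset.prod_pos fun _ _ => stdNormal_pos _)
    (Finset.prod_pos fun _ _ => Finset.prod_pos fun _ _ => stdNormal_pos _)

lemma normalFactor_nonneg (k : ℝ) (ω y : TriCoords p) : 0 ≤ normalFactor p k ω y :=
  mul_nonneg (Finset.prod_nonneg fun _ _ => (stdNormal_pos _).le)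
    (Finset.prod_nonneg fun _ _ => Finset.prod_nonneg fun _ _ => (stdNormal_pos _).le)

lemma normalFactor_le_one (k : ℝ) (ω y : TriCoords p) : normalFactor p k ω y ≤ 1 :=
  mul_le_one₀ (Finset.prod_le_one (fun _ _ => (stdNormal_pos _).le) fun _ _ => stdNormal_le_one _)
    (Finset.prod_nonneg fun _ _ => Finset.prod_nonneg fun _ _ => (stdNormal_pos _).le)
    (Finset.prod_le_one (fun _ _ => Finset.prod_nonneg fun _ _ => (stdNormal_pos _).le)
      fun _ _ => Finset.prod_le_one (fun _ _ => (stdNormal_pos _).le) fun _ _ => stdNormal_le_one _)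

lemma continuous_triMat_apply (i j : Fin p) : Continuous fun y : TriCoords p => triMat y i j := by
  by_cases h : j ≤ i
  · simpa [triMat, h] using continuous_apply (⟨(i, j), h⟩ : LowIdx p)
  · simpa [triMat, h] using continuous_const

lemma measurable_normalFactor (k : ℝ) (ω : TriCoords p) : Measurable (normalFactor p k ω) := by
  have h (i j : Fin p) : Measurable fun y : TriCoords p => (triMat y * thetaK p k ω) i j := by
    simp only [Matrix.mul_apply]
    exact Finset.measurable_fun_sum _ fun l _ =>
      (continuous_triMat_apply i l).measurable.mul_const _
  have hs := continuous_stdNormal.measurable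
  refine Measurable.mul (Finset.measurable_fun_prod _ fun i _ => ?_)
    (Finset.measurable_fun_prod _ fun i _ => Finset.measurable_fun_prod _ fun j _ => ?_)
  · exact hs.comp ((Real.measurable_log.comp (h i i)).div_const k)
  · exact hs.comp ((h i j).div ((h i i).mul_const _))

lemma thetaK_of_lt (k : ℝ) (ω : TriCoords p) {i j : Fin p} (h : i < j) : thetaK p k ω i j = 0 := by
  simp [thetaK, h.not_ge]

lemma thetaK_diag (k : ℝ) (ω : TriCoords p) (i : Fin p) :
    thetaK p k ω i i = Real.exp (k * ω ⟨(i, i), le_rfl⟩) := by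
  simp [thetaK]

lemma thetaK_apply (k : ℝ) (ω : TriCoords p) (i j : Fin p) :
    thetaK p k ω i j = kScale p k i j * (if i = j then 1 else triMat ω i j) *
      Real.exp (k * ω ⟨(i, i), le_rfl⟩) := by
  by_cases hij : i = j
  · subst hij
    simp [thetaK, kScale]
  · by_cases h : j ≤ i <;> simp [thetaK, triMat, hij, h]

lemma mul_thetaK_diag (k : ℝ) (ω y : TriCoords p) (i : Fin p) :
    (triMat y * thetaK p k ω) i i =
      y ⟨(i, i), le_rfl⟩ * Real.exp (k * ω ⟨(i, i), le_rfl⟩) := by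
  rw [triMat_mul_apply_diag y (fun i j h => thetaK_of_lt k ω h), thetaK_diag]

lemma kScale_pos {k : ℝ} (hk : 0 < k) (i j : Fin p) : 0 < kScale p k i j :=
  Real.rpow_pos_of_pos hk _

lemma tendsto_exp_mul_sub_log {c : ℝ} (hc : 0 < c) (d : ℝ) :
    Tendsto (fun k : ℝ => Real.exp (k * (d - c * Real.log k))) atTop (𝓝 0) := by
  refine Real.tendsto_exp_atBot.comp (tendsto_id.atTop_mul_atBot₀ ?_)
  exact tendsto_atBot_add_const_left _ d
    (tendsto_neg_atTop_atBot.comp (Real.tendsto_log_atTop.const_mul_atTop hc)) |>.congr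
    fun k => by simp [sub_eq_add_neg]

lemma tendsto_scaled_term (ω : TriCoords p) {y : TriCoords p} (hy : y ∈ triPos p)
    {i j : Fin p} (hij : j < i) (l : Fin p) :
    Tendsto (fun k : ℝ => triMat y i l * thetaK p k ω l j /
      ((triMat y * thetaK p k ω) i i * kScale p k i j)) atTop
      (𝓝 (if l = i then triMat ω i j else 0)) := by
  have hyi : y ⟨(i, i), le_rfl⟩ ≠ 0 := (hy i).ne'
  rcases lt_trichotomy l i with h | rfl | h
  · have hc : (0 : ℝ) < ((i : ℕ) : ℝ) - (l : ℕ) := sub_pos.2 (by exact_mod_cast h)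
    have := (tendsto_exp_mul_sub_log hc
      (ω ⟨(l, l), le_rfl⟩ - ω ⟨(i, i), le_rfl⟩)).const_mul
      (triMat y i l * (if l = j then 1 else triMat ω l j) / y ⟨(i, i), le_rfl⟩)
    rw [mul_zero] at this
    simp only [h.ne, if_false]
    refine this.congr' ?_
    filter_upwards [eventually_gt_atTop 0] with k hk
    have key : Real.exp (k * (ω ⟨(l, l), le_rfl⟩ - ω ⟨(i, i), le_rfl⟩ -
        (((i : ℕ) : ℝ) - (l : ℕ)) * Real.log k)) =
        kScale p k l j * Real.exp (k * ω ⟨(l, l), le_rfl⟩) /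
          (kScale p k i j * Real.exp (k * ω ⟨(i, i), le_rfl⟩)) := by
      rw [kScale, kScale, Real.rpow_def_of_pos hk, Real.rpow_def_of_pos hk, ← Real.exp_add,
        ← Real.exp_add, ← Real.exp_sub]
      congr 1
      ring
    rw [key, mul_thetaK_diag, thetaK_apply]
    have := (kScale_pos hk i j).ne'
    field_simp
  · simp only [if_true]
    refine tendsto_const_nhds.congr' ?_
    filter_upwards [eventually_gt_atTop 0] with k hk
    rw [mul_thetaK_diag, thetaK_apply, triMat_apply_diag, if_neg hij.ne']
    have := (kScale_pos hk l j).ne'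
    field_simp
  · simp [triMat_apply_of_lt y h, h.ne']

lemma tendsto_normalFactor (ω : TriCoords p) {y : TriCoords p} (hy : y ∈ triPos p) :
    Tendsto (fun k : ℝ => normalFactor p k ω y) atTop (𝓝 (normalFactorLim ω)) := by
  refine (tendsto_finsetProd _ fun i _ => ?_).mul
    (tendsto_finsetProd _ fun i _ => tendsto_finsetProd _ fun j hj => ?_)
  · refine (continuous_stdNormal.tendsto _).comp ?_
    have h : Tendsto (fun k : ℝ => Real.log (y ⟨(i, i), le_rfl⟩) / k + ω ⟨(i, i), le_rfl⟩) atTop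
        (𝓝 (0 + ω ⟨(i, i), le_rfl⟩)) :=
      (tendsto_const_nhds.div_atTop tendsto_id).add_const _
    rw [zero_add] at h
    refine h.congr' ?_
    filter_upwards [eventually_gt_atTop 0] with k hk
    rw [mul_thetaK_diag, Real.log_mul (hy i).ne' (Real.exp_ne_zero _), Real.log_exp]
    field_simp
  · refine (continuous_stdNormal.tendsto _).comp ?_
    have hij : j < i := by simpa using hj
    have h := tendsto_finsetSum Finset.univ fun l _ => tendsto_scaled_term ω hy hij l
    simpa [← Finset.sum_div, ← Matrix.mul_apply] using h

lemma exists_det_pow_div_eq (hn : p ≤ n) (hL : memTplus L) (ω : TriCoords p)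
    {k : ℝ} (hk : 0 < k) :
    ∃ c : ℝ, c ≠ 0 ∧ ∀ y ∈ triPos p,
      (∏ i, mulRightCoords L y ⟨(i, i), le_rfl⟩) ^ n /
          ((∏ i, k * (triMat y * thetaK p k ω) i i) *
            ∏ i, ∏ j ∈ Finset.univ.filter (fun j : Fin p => j < i),
              kScale p k i j * (triMat y * thetaK p k ω) i i) =
        c * ∏ i : Fin p, mulRightCoords L y ⟨(i, i), le_rfl⟩ ^ (n - 1 - (i : ℕ)) := by
  obtain ⟨E, hE⟩ : ∃ E : Fin p → ℝ, ∀ i, E i = Real.exp (k * ω ⟨(i, i), le_rfl⟩) :=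
    ⟨_, fun _ => rfl⟩
  have hEpos (i : Fin p) : E i ≠ 0 := hE i ▸ Real.exp_ne_zero _
  have hLi (i : Fin p) : L i i ≠ 0 := (hL.2 i).ne'
  have hS (i j : Fin p) : kScale p k i j ≠ 0 := (kScale_pos hk i j).ne'
  refine ⟨∏ i : Fin p, (L i i / (k * E i)) * ∏ j ∈ Finset.univ.filter (fun j : Fin p => j < i),
    L i i / (kScale p k i j * E i), ?_, fun y hy => ?_⟩
  · exact Finset.prod_ne_zero_iff.2 fun i _ => mul_ne_zero
      (div_ne_zero (hLi i) (mul_ne_zero hk.ne' (hEpos i))) (Finset.prod_ne_zero_iff.2 fun j _ =>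
        div_ne_zero (hLi i) (mul_ne_zero (hS i j) (hEpos i)))
  · rw [← Finset.prod_pow, ← Finset.prod_mul_distrib, ← Finset.prod_mul_distrib,
      ← Finset.prod_div_distrib]
    refine Finset.prod_congr rfl fun i _ => ?_
    have hyi : y ⟨(i, i), le_rfl⟩ ≠ 0 := (hy i).ne'
    have hcard : (Finset.univ.filter (fun j : Fin p => j < i)).card = i := by
      have : (Finset.univ.filter fun l : Fin p => l < i) = Finset.Iio i := by ext; simp
      rw [this, Fin.card_Iio]
    have hprod : ∏ j ∈ Finset.univ.filter (fun j : Fin p => j < i), kScale p k i j ≠ 0 :=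
      Finset.prod_ne_zero_iff.2 fun j _ => hS i j
    have hEi := hEpos i
    have hLii := hLi i
    simp only [mul_thetaK_diag, ← hE, Finset.prod_div_distrib, Finset.prod_mul_distrib,
      Finset.prod_const, hcard, mulRightCoords_diag hL.1]
    obtain ⟨m, hm⟩ : ∃ m, n = m + 1 + (i : ℕ) :=
      ⟨n - 1 - i, by have := i.2.trans_le hn; omega⟩
    rw [hm, show m + 1 + (i : ℕ) - 1 - i = m by omega]
    field_simp
    ring

/-- Up to a nonzero constant, the integrand is a bounded factor times `triWeight`. -/
lemma exists_wishartDens_mul_priorK_eq (hn : p ≤ n) (hL : memTplus L) (ω : TriCoords p)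
    {k : ℝ} (hk : 0 < k) :
    ∃ c : ℝ, c ≠ 0 ∧ ∀ y ∈ triPos p,
      wishartDens p n (triMat y) L * priorK p k (triMat y * thetaK p k ω) =
        c * (normalFactor p k ω y * triWeight n (mulRightCoords L y)) := by
  obtain ⟨c, hc, key⟩ := exists_det_pow_div_eq hn hL ω hk
  refine ⟨c / wishartC p n, div_ne_zero hc (wishartC_pos hn).ne', fun y hy => ?_⟩
  have hz : mulRightCoords L y ∈ triPos p := (mulRightCoords_mem_triPos hL).2 hy
  rw [triWeight_of_mem hz, wishartDens, priorK, normalFactor,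
    ← triMat_mulRightCoords hL.1, det_eq_prod_diag fun i j h => triMat_apply_of_lt _ h]
  simp only [Finset.prod_div_distrib, triMat_apply_diag]
  rw [show ∀ a b c d e f g : ℝ, a * b / c * (d / e * (f / g)) =
    a / (e * g) * (d * f * b / c) by intros; ring, key y hy]
  ring

end Prior

section Limit

variable {p n : ℕ} {L : Matrix (Fin p) (Fin p) ℝ}

lemma tendsto_integral_normalFactor_mul (hL : memTplus L) (ω : TriCoords p)
    {h : TriCoords p → ℝ} (hh : Integrable fun z => h z * triWeight n z) :
    Tendsto (fun k : ℝ => ∫ y, normalFactor p k ω y *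
        (h (mulRightCoords L y) * triWeight n (mulRightCoords L y))) atTop
      (𝓝 (normalFactorLim ω *
        ∫ y, h (mulRightCoords L y) * triWeight n (mulRightCoords L y))) := by
  obtain ⟨c, -, hcv⟩ := exists_integral_comp_mulRightCoords hL
  have hint := (hcv _).1 hh
  rw [← integral_const_mul]
  refine tendsto_integral_filter_of_dominated_convergence
    (fun y => ‖h (mulRightCoords L y) * triWeight n (mulRightCoords L y)‖)
    (.of_forall fun k =>
      (measurable_normalFactor k ω).aestronglyMeasurable.mul hint.aestronglyMeasurable)
    (.of_forall fun k => .of_forall fun y => ?_) hint.norm (.of_forall fun y => ?_)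
  · rw [norm_mul, Real.norm_of_nonneg (normalFactor_nonneg k ω y)]
    exact mul_le_of_le_one_left (norm_nonneg _) (normalFactor_le_one k ω y)
  · by_cases hy : y ∈ triPos p
    · exact (tendsto_normalFactor ω hy).mul_const _
    · simp [triWeight_of_notMem (mt (mulRightCoords_mem_triPos hL).1 hy)]

lemma transpose_mul_triMat_eq (hL : memTplus L) (y : TriCoords p) :
    (triMat y)ᵀ * triMat y = (L⁻¹)ᵀ *
      ((triMat (mulRightCoords L y))ᵀ * triMat (mulRightCoords L y)) * L⁻¹ := by
  have h : triMat y = triMat (mulRightCoords L y) * L⁻¹ := by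
    rw [triMat_mulRightCoords hL.1, Matrix.mul_assoc,
      Matrix.mul_nonsing_inv _ hL.det_ne_zero.isUnit, Matrix.mul_one]
  conv_lhs => rw [h, Matrix.transpose_mul]
  simp only [Matrix.mul_assoc]

lemma mul_mul_apply_mul_eq_sum (A B C : Matrix (Fin p) (Fin p) ℝ) (i j : Fin p) (w : ℝ) :
    (A * B * C) i j * w = ∑ b, ∑ a, A i a * C b j * (B a b * w) := by
  simp only [Matrix.mul_apply, Finset.sum_mul]
  exact Finset.sum_congr rfl fun b _ => Finset.sum_congr rfl fun a _ => by ring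

lemma integrable_conj_gram (A C : Matrix (Fin p) (Fin p) ℝ) (i j : Fin p) :
    Integrable fun z : TriCoords p => (A * ((triMat z)ᵀ * triMat z) * C) i j * triWeight n z := by
  simp only [mul_mul_apply_mul_eq_sum]
  exact integrable_finsetSum _ fun b _ => integrable_finsetSum _ fun a _ =>
    (integrable_gram_triWeight a b).const_mul _

lemma integral_conj_gram (hn : p ≤ n) (A C : Matrix (Fin p) (Fin p) ℝ) (i j : Fin p) :
    ∫ z : TriCoords p, (A * ((triMat z)ᵀ * triMat z) * C) i j * triWeight n z =
      (A * Matrix.diagonal (fun i : Fin p => (n : ℝ) + p - 2 * ((i : ℕ) : ℝ) - 1) * C) i j *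
        ∫ z : TriCoords p, triWeight n z := by
  simp only [mul_mul_apply_mul_eq_sum]
  rw [integral_finsetSum _ fun b _ => integrable_finsetSum _ fun a _ =>
    (integrable_gram_triWeight a b).const_mul _]
  refine Finset.sum_congr rfl fun b _ => ?_
  rw [integral_finsetSum _ fun a _ => (integrable_gram_triWeight a b).const_mul _]
  refine Finset.sum_congr rfl fun a _ => ?_
  rw [integral_const_mul, integral_gram_triWeight hn]

lemma setIntegral_mul_wishart_prior (hL : memTplus L) {ω : TriCoords p} {k c : ℝ}
    (hc : ∀ y ∈ triPos p,
      wishartDens p n (triMat y) L * priorK p k (triMat y * thetaK p k ω) =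
        c * (normalFactor p k ω y * triWeight n (mulRightCoords L y)))
    {g h : TriCoords p → ℝ} (hgh : ∀ y, g y = h (mulRightCoords L y)) :
    ∫ y in triPos p, g y *
        (wishartDens p n (triMat y) L * priorK p k (triMat y * thetaK p k ω)) =
      c * ∫ y, normalFactor p k ω y *
        (h (mulRightCoords L y) * triWeight n (mulRightCoords L y)) := by
  rw [← integral_const_mul, ← integral_indicator measurableSet_triPos]
  refine integral_congr_ae (.of_forall fun y => ?_)
  by_cases hy : y ∈ triPos p
  · simp only [Set.indicator_of_mem hy, hc y hy, hgh]
    ring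
  · simp [Set.indicator_of_notMem hy,
      triWeight_of_notMem (mt (mulRightCoords_mem_triPos hL).1 hy)]

lemma inv_smul_of_ne_zero {c : ℝ} (hc : c ≠ 0) (A : Matrix (Fin p) (Fin p) ℝ) :
    (c • A)⁻¹ = c⁻¹ • A⁻¹ := by
  by_cases h : IsUnit A.det
  · exact Matrix.inv_smul' A (Units.mk0 c hc) h
  · have h' : ¬ IsUnit (c • A).det := by
      simpa [Matrix.det_smul, hc] using h
    rw [Matrix.nonsing_inv_apply_not_isUnit _ h, Matrix.nonsing_inv_apply_not_isUnit _ h',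
      smul_zero]

end Limit

/-- (Lemma 3.1) The Bayes estimators `δ*_k(L | Θ_k(ω))` converge, as `k → ∞`, to the
James–Stein estimator `L diag(d₁, …, d_p) Lᵀ` with `d_i = 1/(n+p-2i+1)`. -/
theorem bayes_tendsto_james_stein
    (p n : ℕ) (hp : 1 ≤ p) (hn : p ≤ n)
    (Lm : Matrix (Fin p) (Fin p) ℝ) (hL : memTplus Lm) (ω : TriCoords p) :
    Tendsto (fun k : ℝ =>
        (∫ y in triPos p,
            wishartDens p n (triMat y) Lm * priorK p k (triMat y * thetaK p k ω)) •
          (Matrix.of fun i j : Fin p =>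
            ∫ y in triPos p,
              ((triMat y)ᵀ * triMat y) i j *
                (wishartDens p n (triMat y) Lm * priorK p k (triMat y * thetaK p k ω)))⁻¹)
      atTop
      (𝓝 (Lm * Matrix.diagonal (fun i : Fin p =>
        ((n : ℝ) + (p : ℝ) - 2 * ((i : ℕ) : ℝ) - 1)⁻¹) * Lmᵀ)) := by
  set M : ℝ → Matrix (Fin p) (Fin p) ℝ := fun k => Matrix.of fun i j => ∫ y, normalFactor p k ω y *
    (((Lm⁻¹)ᵀ * ((triMat (mulRightCoords Lm y))ᵀ * triMat (mulRightCoords Lm y)) * Lm⁻¹) i j *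
      triWeight n (mulRightCoords Lm y)) with hM
  set S : ℝ → ℝ := fun k => ∫ y, normalFactor p k ω y *
    (1 * triWeight n (mulRightCoords Lm y)) with hS
  have hratio : ∀ k : ℝ, 0 < k → S k • (M k)⁻¹ =
      (∫ y in triPos p,
          wishartDens p n (triMat y) Lm * priorK p k (triMat y * thetaK p k ω)) •
        (Matrix.of fun i j : Fin p =>
          ∫ y in triPos p,
            ((triMat y)ᵀ * triMat y) i j *
              (wishartDens p n (triMat y) Lm * priorK p k (triMat y * thetaK p k ω)))⁻¹ := by
    intro k hk
    obtain ⟨c, hc0, hc⟩ := exists_wishartDens_mul_priorK_eq hn hL ω hk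
    have h1 := setIntegral_mul_wishart_prior hL hc (g := fun _ => 1) (h := fun _ => 1)
      fun _ => rfl
    simp only [one_mul] at h1
    have h2 : (Matrix.of fun i j : Fin p =>
          ∫ y in triPos p,
            ((triMat y)ᵀ * triMat y) i j *
              (wishartDens p n (triMat y) Lm * priorK p k (triMat y * thetaK p k ω))) =
        c • M k := by
      ext i j
      exact setIntegral_mul_wishart_prior hL hc
        (g := fun y => ((triMat y)ᵀ * triMat y) i j)
        (h := fun z => ((Lm⁻¹)ᵀ * ((triMat z)ᵀ * triMat z) * Lm⁻¹) i j)
        fun y => by rw [transpose_mul_triMat_eq hL y]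
    rw [h1, h2, inv_smul_of_ne_zero hc0, smul_smul, hS]
    simp only [one_mul]
    congr 1
    field_simp
  refine Tendsto.congr' ((eventually_gt_atTop 0).mono hratio) ?_
  set d : Fin p → ℝ := fun i => (n : ℝ) + p - 2 * ((i : ℕ) : ℝ) - 1 with hd
  have hdpos (i : Fin p) : 0 < d i := by
    have h1 : ((i : ℕ) : ℝ) + 1 ≤ p := by exact_mod_cast i.2
    have h2 : (p : ℝ) ≤ n := by exact_mod_cast hn
    simp only [hd]
    linarith
  obtain ⟨c, hc, hcv⟩ := exists_integral_comp_mulRightCoords hL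
  set I : ℝ := normalFactorLim ω * (c * ∫ z : TriCoords p, triWeight n z) with hI
  have hIpos : 0 < I := mul_pos (normalFactorLim_pos ω) (mul_pos hc integral_triWeight_pos)
  have hlimS : Tendsto S atTop (𝓝 I) := by
    have := tendsto_integral_normalFactor_mul (n := n) hL ω (h := fun _ => 1)
      (by simpa using integrable_triWeight)
    simpa only [hS, hI, one_mul, (hcv _).2] using this
  have hlimM : Tendsto M atTop (𝓝 (I • ((Lm⁻¹)ᵀ * Matrix.diagonal d * Lm⁻¹))) := by
    refine tendsto_pi_nhds.2 fun i => tendsto_pi_nhds.2 fun j => ?_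
    have := tendsto_integral_normalFactor_mul (n := n) hL ω
      (integrable_conj_gram (Lm⁻¹)ᵀ Lm⁻¹ i j)
    rw [(hcv fun z => ((Lm⁻¹)ᵀ * ((triMat z)ᵀ * triMat z) * Lm⁻¹) i j * triWeight n z).2,
      integral_conj_gram hn] at this
    convert this using 2
    · rfl
    · simp only [Matrix.smul_apply, smul_eq_mul, hI, hd]
      ring
  have hu : IsUnit Lm.det := hL.det_ne_zero.isUnit
  have hdinv : (Matrix.diagonal d)⁻¹ = Matrix.diagonal fun i => (d i)⁻¹ := by
    refine Matrix.inv_eq_right_inv ?_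
    rw [Matrix.diagonal_mul_diagonal, ← Matrix.diagonal_one]
    congr 1
    ext i
    exact mul_inv_cancel₀ (hdpos i).ne'
  have hinv : (I • ((Lm⁻¹)ᵀ * Matrix.diagonal d * Lm⁻¹))⁻¹ =
      I⁻¹ • (Lm * Matrix.diagonal (fun i => (d i)⁻¹) * Lmᵀ) := by
    rw [inv_smul_of_ne_zero hIpos.ne', Matrix.mul_inv_rev, Matrix.mul_inv_rev, hdinv, Matrix.nonsing_inv_nonsing_inv _ hu,
      Matrix.transpose_nonsing_inv, Matrix.nonsing_inv_nonsing_inv _ (by simpa using hu),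
      Matrix.mul_assoc]
  have hdet : (I • ((Lm⁻¹)ᵀ * Matrix.diagonal d * Lm⁻¹)).det ≠ 0 := by
    simp [Matrix.det_mul, Finset.prod_ne_zero_iff, (hdpos _).ne', hL.det_ne_zero, hIpos.ne']
  have hcont := continuousAt_matrix_inv (I • ((Lm⁻¹)ᵀ * Matrix.diagonal d * Lm⁻¹)) (by
    rw [Ring.inverse_eq_inv']
    exact continuousAt_inv₀ hdet)
  have := hlimS.smul (hcont.tendsto.comp hlimM)
  rw [hinv, smul_smul, mul_inv_cancel₀ hIpos.ne', one_smul] at this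
  exact this
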